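/- Let V be a finite-dimensional complex vector space, W ⊆ V a real subspace with W + iW = V, and set U := W ∩ iW. An ℝ-bilinear alternating map T : W × W → W (values in W) can be written as T(w₁, w₂) = A(w₁)w₂ − A(w₂)w₁ for some ℝ-linear map A : W → End_ℂ(V) if and only if, for all u₁, u₂ ∈ U: (a) T(u₁, u₂) − T(iu₁, iu₂) ∈ U, and (b) T(u₁, u₂) − T(iu₁, iu₂) = −i·T(iu₁, u₂) − i·T(u₁, iu₂). -/

import Mathlib

/-- A real-linear projection of `W` onto its maximal complex subspace, followed by
multiplication by the imaginary unit. -/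
lemma exists_projection_maximal_complex_subspace {V : Type*} [AddCommGroup V] [Module ℂ V]
    (W : Submodule ℝ V) :
    ∃ p j : W →ₗ[ℝ] W, (∀ w, (j w : V) = Complex.I • (p w : V)) ∧
      ∀ w : W, Complex.I • (w : V) ∈ W → p w = w := by
  let m : V →ₗ[ℝ] V := (LinearMap.lsmul ℂ V Complex.I).restrictScalars ℝ
  let U : Submodule ℝ W := W.comap (m ∘ₗ W.subtype)
  obtain ⟨π, hπ⟩ := U.subtype.exists_leftInverse_of_injective (by simp)
  let J : U →ₗ[ℝ] W := (m ∘ₗ W.subtype ∘ₗ U.subtype).codRestrict W fun u ↦ u.2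
  refine ⟨U.subtype ∘ₗ π, J ∘ₗ π, fun w ↦ rfl, fun w hw ↦ ?_⟩
  have h := LinearMap.congr_fun hπ (⟨w, hw⟩ : U)
  exact congrArg Subtype.val h

/-- A real-linear family of real-linear maps on a generic real subspace `W`, complex linear on
the maximal complex subspace of `W`, extends to a real-linear family of complex-linear maps. -/
lemma exists_complex_linear_extension {V E M : Type*} [AddCommGroup V] [Module ℂ V]
    [AddCommGroup E] [Module ℂ E] [AddCommGroup M] [Module ℝ M] (W : Submodule ℝ V)
    (hgen : ∀ v : V, ∃ w₁ ∈ W, ∃ w₂ ∈ W, v = w₁ + Complex.I • w₂)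
    (F : M →ₗ[ℝ] W →ₗ[ℝ] E)
    (hF : ∀ (x : M) (u u' : W), (u' : V) = Complex.I • (u : V) → F x u' = Complex.I • F x u) :
    ∃ A : M →ₗ[ℝ] (V →ₗ[ℂ] E), ∀ (x : M) (w : W), A x w = F x w := by
  let m : V →ₗ[ℝ] V := (LinearMap.lsmul ℂ V Complex.I).restrictScalars ℝ
  let q : W × W →ₗ[ℝ] V := W.subtype.coprod (m ∘ₗ W.subtype)
  have hq : ∀ a b : W, q (a, b) = (a : V) + Complex.I • (b : V) := fun a b ↦ by
    simp [q, m]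
  obtain ⟨s, hs⟩ := q.exists_rightInverse_of_surjective (LinearMap.range_eq_top.2 fun v ↦ by
    obtain ⟨a, ha, b, hb, rfl⟩ := hgen v
    exact ⟨(⟨a, ha⟩, ⟨b, hb⟩), hq _ _⟩)
  have hsv : ∀ v, ((s v).1 : V) + Complex.I • ((s v).2 : V) = v := fun v ↦ by
    rw [← hq]
    exact LinearMap.congr_fun hs v
  have key : ∀ (x : M) (a b : W) (v : V), v = (a : V) + Complex.I • (b : V) →
      F x (s v).1 + Complex.I • F x (s v).2 = F x a + Complex.I • F x b := by
    intro x a b v hv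
    have h := hF x (b - (s v).2) ((s v).1 - a) (by
      have h := (hsv v).trans hv
      push_cast
      rw [smul_sub, sub_eq_sub_iff_add_eq_add, h, add_comm])
    simp only [map_sub, smul_sub] at h
    rw [sub_eq_sub_iff_add_eq_add] at h
    rw [h, add_comm]
  have hI : ∀ (x : M) (v : V), F x (s (Complex.I • v)).1 + Complex.I • F x (s (Complex.I • v)).2
      = Complex.I • (F x (s v).1 + Complex.I • F x (s v).2) := by
    intro x v
    rw [key x (-(s v).2) (s v).1 (Complex.I • v) ?_]
    · rw [map_neg, smul_add, smul_smul, Complex.I_mul_I]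
      module
    · conv_lhs => rw [← hsv v]
      rw [smul_add, smul_smul, Complex.I_mul_I]
      push_cast
      module
  let B : M →ₗ[ℝ] V →ₗ[ℝ] E := LinearMap.mk₂ ℝ
    (fun x v ↦ F x (s v).1 + Complex.I • F x (s v).2)
    (fun x y v ↦ by simp only [map_add, LinearMap.add_apply]; module)
    (fun c x v ↦ by
      simp only [map_smul, LinearMap.smul_apply, smul_add, smul_comm c Complex.I])
    (fun x v w ↦ by simp only [map_add, Prod.fst_add, Prod.snd_add]; module)
    (fun c x v ↦ by
      simp only [map_smul, Prod.smul_fst, Prod.smul_snd, smul_add, smul_comm c Complex.I])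
  have hB : ∀ (x : M) (c : ℂ) (v : V), B x (c • v) = c • B x v := by
    intro x c v
    have hIv : B x (Complex.I • v) = Complex.I • B x v := hI x v
    have hcV : c • v = c.re • v + c.im • Complex.I • v := by
      conv_lhs => rw [← Complex.re_add_im c]
      rw [add_smul, mul_smul, Complex.coe_smul, Complex.coe_smul]
    have hcE : c • B x v = c.re • B x v + c.im • Complex.I • B x v := by
      conv_lhs => rw [← Complex.re_add_im c]
      rw [add_smul, mul_smul, Complex.coe_smul, Complex.coe_smul]
    rw [hcV, map_add, map_smul, map_smul, hIv, hcE]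
  refine ⟨{ toFun := fun x ↦ { toFun := B x, map_add' := map_add (B x), map_smul' := hB x }
            map_add' := fun x y ↦ by ext v; simp
            map_smul' := fun c x ↦ by ext v; simp }, fun x w ↦ ?_⟩
  change F x (s w).1 + Complex.I • F x (s w).2 = F x w
  rw [key x w 0 w (by simp)]
  simp

/-- Let `W` be a generic real subspace of a finite-dimensional complex vector space `V`
(`W + iW = V`) and `U = W ∩ iW`. An ℝ-bilinear alternating map `T : W × W → W` is of the
form `T(w₁,w₂) = A(w₁)w₂ − A(w₂)w₁` for some ℝ-linear `A : W → End_ℂ(V)` if and only if,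
for all `u₁, u₂ ∈ U`, (a) `T(u₁,u₂) − T(iu₁,iu₂) ∈ U` and
(b) `T(u₁,u₂) − T(iu₁,iu₂) = −i T(iu₁,u₂) − i T(u₁,iu₂)`. -/
theorem mem_coboundary_iff_CR_integrability
    (V : Type*) [AddCommGroup V] [Module ℂ V] [FiniteDimensional ℂ V]
    (W : Submodule ℝ V)
    (hgen : ∀ v : V, ∃ w₁ ∈ W, ∃ w₂ ∈ W, v = w₁ + Complex.I • w₂)
    (T : W →ₗ[ℝ] W →ₗ[ℝ] W) (halt : ∀ w : W, T w w = 0) :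
    (∃ A : W →ₗ[ℝ] (V →ₗ[ℂ] V),
        ∀ w₁ w₂ : W, (T w₁ w₂ : V) = A w₁ ↑w₂ - A w₂ ↑w₁) ↔
    (∀ (u₁ u₂ : V) (h₁ : u₁ ∈ W) (h₁' : Complex.I • u₁ ∈ W)
        (h₂ : u₂ ∈ W) (h₂' : Complex.I • u₂ ∈ W),
      ((T ⟨u₁, h₁⟩ ⟨u₂, h₂⟩ : V) - (T ⟨Complex.I • u₁, h₁'⟩ ⟨Complex.I • u₂, h₂'⟩ : V) ∈ W ∧
        Complex.I • ((T ⟨u₁, h₁⟩ ⟨u₂, h₂⟩ : V)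
          - (T ⟨Complex.I • u₁, h₁'⟩ ⟨Complex.I • u₂, h₂'⟩ : V)) ∈ W) ∧
      (T ⟨u₁, h₁⟩ ⟨u₂, h₂⟩ : V) - (T ⟨Complex.I • u₁, h₁'⟩ ⟨Complex.I • u₂, h₂'⟩ : V)
        = - (Complex.I • (T ⟨Complex.I • u₁, h₁'⟩ ⟨u₂, h₂⟩ : V))
          - Complex.I • (T ⟨u₁, h₁⟩ ⟨Complex.I • u₂, h₂'⟩ : V)) := by
  constructor
  · rintro ⟨A, hA⟩ u₁ u₂ h₁ h₁' h₂ h₂'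
    have hb : (T ⟨u₁, h₁⟩ ⟨u₂, h₂⟩ : V) - (T ⟨Complex.I • u₁, h₁'⟩ ⟨Complex.I • u₂, h₂'⟩ : V)
        = - (Complex.I • (T ⟨Complex.I • u₁, h₁'⟩ ⟨u₂, h₂⟩ : V))
          - Complex.I • (T ⟨u₁, h₁⟩ ⟨Complex.I • u₂, h₂'⟩ : V) := by
      simp only [hA, map_smul, smul_sub, smul_smul, Complex.I_mul_I]
      module
    refine ⟨⟨W.sub_mem (SetLike.coe_mem _) (SetLike.coe_mem _), ?_⟩, hb⟩
    rw [hb]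
    have : Complex.I • (-(Complex.I • (T ⟨Complex.I • u₁, h₁'⟩ ⟨u₂, h₂⟩ : V))
          - Complex.I • (T ⟨u₁, h₁⟩ ⟨Complex.I • u₂, h₂'⟩ : V))
        = (T ⟨Complex.I • u₁, h₁'⟩ ⟨u₂, h₂⟩ : V) + T ⟨u₁, h₁⟩ ⟨Complex.I • u₂, h₂'⟩ := by
      simp only [smul_sub, smul_neg, smul_smul, Complex.I_mul_I]
      module
    rw [this]
    exact W.add_mem (SetLike.coe_mem _) (SetLike.coe_mem _)
  · intro H
    obtain ⟨p, j, hj, hp⟩ := exists_projection_maximal_complex_subspace W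
    let S : W →ₗ[ℝ] W →ₗ[ℝ] V := T.compr₂ W.subtype
    have hS : ∀ x y, (T x y : V) = S x y := fun x y ↦ rfl
    have hanti : ∀ x y, S x y = - S y x := by
      intro x y
      have h := halt (x + y)
      simp only [map_add, LinearMap.add_apply, halt, zero_add, add_zero] at h
      rw [← hS, ← hS, ← Submodule.coe_neg, eq_neg_of_add_eq_zero_right h]
    have hb : ∀ x u u' : W, (u' : V) = Complex.I • (u : V) →
        S (p x) u - S (j x) u' = -(Complex.I • S (j x) u) - Complex.I • S (p x) u' := by
      intro x u u' hu
      have h := (H (p x) u (p x).2 (hj x ▸ (j x).2) u.2 (hu ▸ u'.2)).2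
      have hu' : (⟨Complex.I • (u : V), hu ▸ u'.2⟩ : W) = u' := Subtype.ext hu.symm
      have hjx : (⟨Complex.I • (p x : V), hj x ▸ (j x).2⟩ : W) = j x := Subtype.ext (hj x).symm
      rw [hu', hjx] at h
      exact h
    let F : W →ₗ[ℝ] W →ₗ[ℝ] V := LinearMap.mk₂ ℝ
      (fun x y ↦ (1 / 4 : ℝ) • (S (p x) (p y) + S (j x) (j y))
        - (1 / 2 : ℝ) • Complex.I • S (p x) (j y)
        + S (p x) (y - p y) + (1 / 2 : ℝ) • S (x - p x) (y - p y))
      (fun x y z ↦ by simp only [map_add, map_sub, LinearMap.add_apply, LinearMap.sub_apply]; module)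
      (fun c x y ↦ by
        simp only [map_smul, map_sub, LinearMap.smul_apply, LinearMap.sub_apply,
          smul_comm Complex.I c]
        module)
      (fun x y z ↦ by simp only [map_add, map_sub]; module)
      (fun c x y ↦ by
        simp only [map_smul, map_sub, smul_comm Complex.I c]
        module)
    have hF : ∀ x y, F x y = (1 / 4 : ℝ) • (S (p x) (p y) + S (j x) (j y))
        - (1 / 2 : ℝ) • Complex.I • S (p x) (j y)
        + S (p x) (y - p y) + (1 / 2 : ℝ) • S (x - p x) (y - p y) := fun x y ↦ rfl
    obtain ⟨A, hA⟩ := exists_complex_linear_extension W hgen F (by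
      intro x u u' hu
      have hpu : p u = u := hp u (hu ▸ u'.2)
      have hIu' : Complex.I • (u' : V) = ((-u : W) : V) := by
        rw [hu, smul_smul, Complex.I_mul_I]; simp
      have hpu' : p u' = u' := hp u' (hIu' ▸ (-u).2)
      have hju : j u = u' := Subtype.ext (by rw [hj, hpu, hu])
      have hju' : j u' = -u := Subtype.ext (by rw [hj, hpu', hIu'])
      have h := congrArg (fun v ↦ Complex.I • v) (hb x u u' hu)
      simp only [smul_sub, smul_neg, smul_smul, Complex.I_mul_I] at h
      simp only [hF, hpu, hpu', hju, hju', sub_self, map_zero, map_neg, smul_zero, add_zero,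
        smul_sub, smul_add, smul_comm Complex.I (_ : ℝ), smul_smul Complex.I Complex.I,
        Complex.I_mul_I]
      linear_combination (norm := module) (1 / 4 : ℝ) • h)
    refine ⟨A, fun x y ↦ ?_⟩
    rw [hA, hA, hS, hF, hF]
    have h := hb x (p y) (j y) (hj y)
    simp only [map_sub, LinearMap.sub_apply]
    rw [hanti (p y) (p x), hanti (j y) (j x), hanti (p y) (j x), hanti (p y) x, hanti y x,
      hanti y (p x)]
    simp only [smul_neg]
    linear_combination (norm := module) (1 / 2 : ℝ) • h
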